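/- arXiv:2207.03588 — 10 statements merged into one kernel-verified Lean document; each statement's English description precedes it below -/
import Mathlib

section
/- In the lattice of set-based judged runs with the replacement [set-based] ordering, an element j is join-irreducible if and only if there exist a relevance degree m with 1 ≤ m ≤ c and a length t with 1 ≤ t ≤ N such that j i = m for all i < t and j i = 0 for all i ≥ t (i.e. the join-irreducible runs are exactly those of the form {a_m,…,a_m,a_0,…,a_0}). -/
/-- A set-based judged run: relevance degrees listed in decreasing order. -/
abbrev SRun (N c : ℕ) := {r : Fin N → Fin (c + 1) // Antitone r}

/-- The replacement [set-based] ordering coincides with the pointwise order on antitone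
runs, and pointwise max/min of antitone runs are antitone, giving a lattice. -/
instance (N c : ℕ) : Lattice (SRun N c) :=
  Subtype.lattice (fun _ _ hx hy => hx.sup hy) (fun _ _ hx hy => hx.inf hy)


theorem srun_sup_apply (N c : ℕ) (a b : SRun N c) (i : Fin N) :
    (a ⊔ b).1 i = a.1 i ⊔ b.1 i := rfl

theorem srun_ext (N c : ℕ) (a b : SRun N c) (h : ∀ i, (a.1 i : ℕ) = b.1 i) : a = b :=
  Subtype.ext (funext fun i => Fin.ext (h i))

theorem srun_key (N c m t : ℕ) (j b : SRun N c)
    (hj : ∀ i : Fin N, ((i : ℕ) < t → (j.1 i : ℕ) = m) ∧ (t ≤ (i : ℕ) → (j.1 i : ℕ) = 0))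
    (hb : ∀ i, (b.1 i : ℕ) ≤ j.1 i) (k : Fin N) (hk : (k : ℕ) + 1 = t)
    (hbk : (b.1 k : ℕ) = m) : b = j := by
  apply srun_ext
  intro i
  have h1 := hb i
  by_cases hi : (i : ℕ) < t
  · have h2 : (b.1 k : ℕ) ≤ b.1 i := b.2 (show i ≤ k from by rw [Fin.le_def]; omega)
    have := (hj i).1 hi
    omega
  · have := (hj i).2 (by omega)
    omega

/-- In the lattice of set-based judged runs with the replacement [set-based] ordering,
an element `j` is join-irreducible iff it is of the form `{a_m, …, a_m, a_0, …, a_0}`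
for some relevance degree `1 ≤ m ≤ c` and some length `1 ≤ t ≤ N`. -/
theorem setBased_supIrred_iff (N c : ℕ) (hN : 1 ≤ N) (hc : 1 ≤ c) (j : SRun N c) :
    SupIrred j ↔ ∃ m t : ℕ, 1 ≤ m ∧ m ≤ c ∧ 1 ≤ t ∧ t ≤ N ∧
      ∀ i : Fin N, ((i : ℕ) < t → (j.1 i : ℕ) = m) ∧ (t ≤ (i : ℕ) → (j.1 i : ℕ) = 0) := by
  constructor
  · rintro ⟨hmin, hirr⟩
    have hex : ∃ i, j.1 i ≠ 0 := by
      by_contra! h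
      apply hmin
      intro b _ i
      show j.1 i ≤ b.1 i
      rw [h i]
      exact Fin.zero_le _
    obtain ⟨k, hk, hmax⟩ : ∃ k, j.1 k ≠ 0 ∧ ∀ i, k < i → j.1 i = 0 := by
      obtain ⟨k, hk, hm⟩ := (Finset.univ.filter fun i => j.1 i ≠ 0).exists_max_image id
        (by obtain ⟨i, hi⟩ := hex; exact ⟨i, by simpa using hi⟩)
      refine ⟨k, by simpa using hk, fun i hi => ?_⟩
      by_contra h
      exact absurd (hm i (by simpa using h)) (not_le.2 hi)
    have hb : Antitone fun i => j.1 i ⊓ j.1 k := fun x y hxy =>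
      inf_le_inf_right _ (j.2 hxy)
    have hd : Antitone fun i => if j.1 k < j.1 i then j.1 i else 0 := by
      intro x y hxy
      have := j.2 hxy
      dsimp only
      split_ifs with h1 h2
      · exact this
      · exact absurd (h1.trans_le this) h2
      · exact Fin.zero_le _
      · exact le_rfl
    have hkey := hirr (b := ⟨_, hb⟩) (c := ⟨_, hd⟩) (by
      apply Subtype.ext
      funext i
      rw [srun_sup_apply]
      dsimp only
      split_ifs with h
      · exact sup_eq_right.2 inf_le_left
      · rw [inf_eq_left.2 (not_lt.1 h)]
        exact sup_eq_left.2 (Fin.zero_le _))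
    have hall : ∀ i, i ≤ k → j.1 i = j.1 k := by
      intro i hi
      rcases hkey with h | h
      · have := congrFun (congrArg Subtype.val h) i
        exact le_antisymm (inf_eq_left.1 this) (j.2 hi)
      · have := congrFun (congrArg Subtype.val h) k
        simp at this
        exact absurd this.symm hk
    have hk' : (j.1 k : ℕ) ≠ 0 := fun h => hk (Fin.ext h)
    refine ⟨j.1 k, k + 1, by omega, by omega, by omega, by omega, fun i => ⟨fun h => ?_, fun h => ?_⟩⟩
    · rw [hall i (by rw [Fin.le_def]; omega)]
    · rw [hmax i (by rw [Fin.lt_def]; omega)]; rfl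
  · rintro ⟨m, t, hm, hmc, ht, htN, hj⟩
    have hk := (hj ⟨t - 1, by omega⟩).1 (by simp; omega)
    refine ⟨fun hmin => ?_, fun b d hbd => ?_⟩
    · have h0 : (⟨fun _ => 0, fun _ _ _ => le_rfl⟩ : SRun N c) ≤ j := fun i => Fin.zero_le _
      have := hmin h0 ⟨t - 1, by omega⟩
      have h2 : (j.1 ⟨t - 1, by omega⟩ : ℕ) ≤ 0 := this
      omega
    · have hs : ∀ i, b.1 i ⊔ d.1 i = j.1 i := fun i => by rw [← hbd]; rfl
      have h1 : ∀ i, (b.1 i : ℕ) ≤ j.1 i := fun i => by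
        rw [← hs i]; exact (le_sup_left : b.1 i ≤ b.1 i ⊔ d.1 i)
      have h2 : ∀ i, (d.1 i : ℕ) ≤ j.1 i := fun i => by
        rw [← hs i]; exact (le_sup_right : d.1 i ≤ b.1 i ⊔ d.1 i)
      have h3 := hs ⟨t - 1, by omega⟩
      rcases le_total (b.1 ⟨t - 1, by omega⟩) (d.1 ⟨t - 1, by omega⟩) with h | h
      · right
        rw [sup_eq_right.2 h] at h3
        exact srun_key N c m t j d hj h2 ⟨t - 1, by omega⟩ (by simp; omega) (by rw [h3, hk])
      · left
        rw [sup_eq_left.2 h] at h3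
        exact srun_key N c m t j b hj h1 ⟨t - 1, by omega⟩ (by simp; omega) (by rw [h3, hk])
end

section
/- In the lattice of set-based judged runs with the replacement [set-based] ordering, for every run r the number of join-irreducible elements j with j ≤ r equals the sum of the relevance degrees of r, i.e. card{j : j is join-irreducible and j ≤ r} = Σ_{i=0}^{N−1} (r i : ℕ). -/
/-- The rectangle run: value `k` up to index `i`, and `0` after it. -/
def SRun.rect {N c : ℕ} (i : Fin N) (k : Fin (c + 1)) : SRun N c :=
  ⟨fun x => if x ≤ i then k else 0, by
    intro x y hxy
    dsimp only
    split_ifs with h1 h2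
    · exact le_rfl
    · exact absurd (hxy.trans h1) h2
    · exact Fin.zero_le _
    · exact le_rfl⟩

lemma SRun.rect_apply {N c : ℕ} (i : Fin N) (k : Fin (c + 1)) (x : Fin N) :
    (SRun.rect i k).1 x = if x ≤ i then k else 0 := rfl

lemma SRun.rect_le {N c : ℕ} (i : Fin N) (k : Fin (c + 1)) (s : SRun N c) :
    SRun.rect i k ≤ s ↔ k ≤ s.1 i := by
  constructor
  · intro h
    have := h i
    simpa [SRun.rect_apply] using this
  · intro h x
    change (SRun.rect i k).1 x ≤ s.1 x
    rw [SRun.rect_apply]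
    split_ifs with hx
    · exact h.trans (s.2 hx)
    · exact Fin.zero_le _

lemma SRun.sup_apply {N c : ℕ} (a b : SRun N c) (x : Fin N) :
    (a ⊔ b).1 x = a.1 x ⊔ b.1 x := rfl

lemma SRun.supIrred_rect {N c : ℕ} (i : Fin N) (k : Fin (c + 1)) (hk : k ≠ 0) :
    SupIrred (SRun.rect i k) := by
  constructor
  · intro hmin
    have h0 : SRun.rect i (0 : Fin (c + 1)) ≤ SRun.rect i k :=
      (SRun.rect_le _ _ _).2 (Fin.zero_le _)
    have h1 := (SRun.rect_le _ _ _).1 (hmin h0)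
    simp [SRun.rect_apply] at h1
    exact hk h1
  · intro a b hab
    have h1 : a.1 i ⊔ b.1 i = k := by
      rw [← SRun.sup_apply, hab]; simp [SRun.rect_apply]
    have ha : a ≤ SRun.rect i k := hab ▸ le_sup_left
    have hb : b ≤ SRun.rect i k := hab ▸ le_sup_right
    rcases max_choice (a.1 i) (b.1 i) with h | h
    · left
      exact le_antisymm ha ((SRun.rect_le _ _ _).2 (h1.symm.trans h).le)
    · right
      exact le_antisymm hb ((SRun.rect_le _ _ _).2 (h1.symm.trans h).le)

lemma SRun.eq_rect_of_supIrred {N c : ℕ} (j : SRun N c) (hj : SupIrred j) :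
    ∃ i, j.1 i ≠ 0 ∧ SRun.rect i (j.1 i) = j := by
  classical
  have hne : (Finset.univ.filter (fun i => j.1 i ≠ 0)).Nonempty := by
    by_contra hcon
    rw [Finset.not_nonempty_iff_eq_empty, Finset.filter_eq_empty_iff] at hcon
    apply hj.1
    intro b _ x
    have := hcon (Finset.mem_univ x)
    change j.1 x ≤ b.1 x
    rw [not_not.1 this]
    exact Fin.zero_le _
  obtain ⟨i, hi, hmax⟩ := Finset.exists_max_image _ id hne
  simp only [Finset.mem_filter, Finset.mem_univ, true_and, id] at hi hmax
  have hz : ∀ x, i < x → j.1 x = 0 := by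
    intro x hx
    by_contra h
    exact absurd (hmax x h) (not_le.2 hx)
  refine ⟨i, hi, ?_⟩
  let y : SRun N c := ⟨fun x => if x < i then j.1 x else 0, by
    intro x z hxz
    dsimp only
    split_ifs with h1 h2
    · exact j.2 hxz
    · exact absurd (hxz.trans_lt h1) h2
    · exact Fin.zero_le _
    · exact le_rfl⟩
  have hy : ∀ x, y.1 x = if x < i then j.1 x else 0 := fun _ => rfl
  have hsup : SRun.rect i (j.1 i) ⊔ y = j := by
    apply Subtype.ext
    funext x
    rw [SRun.sup_apply, SRun.rect_apply, hy]
    rcases lt_trichotomy x i with h | h | h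
    · rw [if_pos h.le, if_pos h]
      exact max_eq_right (j.2 h.le)
    · subst h
      simp
    · rw [if_neg (not_le.2 h), if_neg (not_lt.2 h.le), hz x h]
      simp
  rcases hj.2 hsup with h | h
  · exact h
  · exfalso
    apply hi
    rw [← h, hy]
    simp

/-- The number of join-irreducible elements below a set-based run `r` (in the
replacement [set-based] ordering) equals the sum of the relevance degrees of `r`. -/
theorem setBased_card_supIrred_le (N c : ℕ) (hN : 1 ≤ N) (hc : 1 ≤ c) (r : SRun N c) :
    Nat.card {j : SRun N c // SupIrred j ∧ j ≤ r} = ∑ i : Fin N, (r.1 i : ℕ) := by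
  classical
  have hlt : ∀ p : (Σ i : Fin N, Fin (r.1 i : ℕ)), (p.2 : ℕ) + 1 < c + 1 := fun p => by
    have h1 := p.2.2
    have h2 := (r.1 p.1).2
    omega
  let f : (Σ i : Fin N, Fin (r.1 i : ℕ)) → {j : SRun N c // SupIrred j ∧ j ≤ r} :=
    fun p => ⟨SRun.rect p.1 ⟨(p.2 : ℕ) + 1, hlt p⟩,
      SRun.supIrred_rect _ _ (by simp [Fin.ext_iff]),
      (SRun.rect_le _ _ _).2 (by rw [Fin.le_def]; exact p.2.2)⟩
  have hf : Function.Bijective f := by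
    constructor
    · rintro ⟨i, k⟩ ⟨i', k'⟩ h
      have h0 : SRun.rect i ⟨(k : ℕ) + 1, hlt ⟨i, k⟩⟩ = SRun.rect i' ⟨(k' : ℕ) + 1, hlt ⟨i', k'⟩⟩ :=
        congrArg Subtype.val h
      have e1 := (SRun.rect_le _ _ _).1 h0.le
      have e2 := (SRun.rect_le _ _ _).1 h0.ge
      rw [SRun.rect_apply] at e1 e2
      have hi : i ≤ i' := by
        by_contra hc
        rw [if_neg hc] at e1
        simp [Fin.le_def] at e1
      have hi' : i' ≤ i := by
        by_contra hc
        rw [if_neg hc] at e2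
        simp [Fin.le_def] at e2
      obtain rfl := le_antisymm hi hi'
      simp only [le_refl, if_true, Fin.le_def] at e1 e2
      have : k = k' := Fin.ext (by omega)
      rw [this]
    · rintro ⟨j, hj, hjr⟩
      obtain ⟨i, hi, hij⟩ := SRun.eq_rect_of_supIrred j hj
      have hle : j.1 i ≤ r.1 i := hjr i
      have hpos : (j.1 i : ℕ) ≠ 0 := fun h => hi (Fin.ext h)
      rw [Fin.le_def] at hle
      refine ⟨⟨i, ⟨(j.1 i : ℕ) - 1, by omega⟩⟩, Subtype.ext ?_⟩
      refine Eq.trans ?_ hij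
      change SRun.rect i _ = SRun.rect i _
      congr 1
      apply Fin.ext
      change (j.1 i : ℕ) - 1 + 1 = _
      omega
  rw [← Nat.card_eq_of_bijective f hf, Nat.card_eq_fintype_card]
  simp
end

section
/- The generalized precision gP and the generalized recall gR are positive valuations on the lattice of set-based judged runs with the replacement [set-based] ordering: for all runs r, s, gP(r ⊔ s) + gP(r ⊓ s) = gP(r) + gP(s) and gR(r ⊔ s) + gR(r ⊓ s) = gR(r) + gR(s); and if r ≤ s with r ≠ s then gP(r) < gP(s) and gR(r) < gR(s). -/
/-- Generalized precision and recall are positive valuations on the lattice of set-based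
judged runs with the replacement [set-based] ordering. -/
theorem setBased_gP_gR_positive_valuation (N c : ℕ) (hN : 1 ≤ N) (hc : 1 ≤ c)
    (g : Fin (c + 1) → ℝ) (hg : StrictMono g) (hg0 : g 0 = 0)
    (RB : ℝ) (hRB : 0 < RB)
    (gP gR : SRun N c → ℝ)
    (hgP : ∀ r : SRun N c, gP r = (1 / ((N : ℝ) * g (Fin.last c))) * ∑ i : Fin N, g (r.1 i))
    (hgR : ∀ r : SRun N c, gR r = (1 / (RB * g (Fin.last c))) * ∑ i : Fin N, g (r.1 i)) :
    (∀ r s : SRun N c, gP (r ⊔ s) + gP (r ⊓ s) = gP r + gP s) ∧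
    (∀ r s : SRun N c, gR (r ⊔ s) + gR (r ⊓ s) = gR r + gR s) ∧
    (∀ r s : SRun N c, r ≤ s → r ≠ s → gP r < gP s ∧ gR r < gR s) := by
  have hgc : 0 < g (Fin.last c) := by
    rw [← hg0]
    apply hg
    rw [Fin.lt_def]
    simp
    omega
  have hNR : (0 : ℝ) < N := by exact_mod_cast hN
  have hval : ∀ r s : SRun N c, ∑ i : Fin N, g ((r ⊔ s).1 i) + ∑ i : Fin N, g ((r ⊓ s).1 i)
      = ∑ i : Fin N, g (r.1 i) + ∑ i : Fin N, g (s.1 i) := by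
    intro r s
    rw [← Finset.sum_add_distrib, ← Finset.sum_add_distrib]
    refine Finset.sum_congr rfl fun i _ => ?_
    change g (r.1 i ⊔ s.1 i) + g (r.1 i ⊓ s.1 i) = _
    rcases le_total (r.1 i) (s.1 i) with h | h
    · rw [sup_eq_right.2 h, inf_eq_left.2 h, add_comm]
    · rw [sup_eq_left.2 h, inf_eq_right.2 h]
  refine ⟨fun r s => ?_, fun r s => ?_, fun r s hle hne => ?_⟩
  · simp only [hgP]
    rw [← mul_add, ← mul_add, hval]
  · simp only [hgR]
    rw [← mul_add, ← mul_add, hval]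
  · have hle' : ∀ i, r.1 i ≤ s.1 i := hle
    have hlt : ∑ i : Fin N, g (r.1 i) < ∑ i : Fin N, g (s.1 i) := by
      obtain ⟨i, hi⟩ : ∃ i, r.1 i ≠ s.1 i := by
        by_contra! h
        exact hne (Subtype.ext (funext h))
      exact Finset.sum_lt_sum (fun i _ => hg.monotone (hle' i))
        ⟨i, Finset.mem_univ i, hg (lt_of_le_of_ne (hle' i) hi)⟩
    rw [hgP, hgP, hgR, hgR]
    exact ⟨mul_lt_mul_of_pos_left hlt (by positivity), mul_lt_mul_of_pos_left hlt (by positivity)⟩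
end

section
/- For antitone runs r, s : Fin N → Fin (c+1), the count condition of the replacement [set-based] ordering is equivalent to the pointwise order: (for every relevance degree j, card{i : j ≤ r i} ≤ card{i : j ≤ s i}) if and only if r i ≤ s i for every i. -/
/-- For antitone runs `r, s : Fin N → Fin (c+1)`, the count condition of the replacement
[set-based] ordering (for every relevance degree `j`, the number of positions of `r`
with degree at least `j` is at most that of `s`) is equivalent to the pointwise order. -/
theorem setBased_replacement_iff_pointwise (N c : ℕ) (hN : 1 ≤ N) (hc : 1 ≤ c)
    (r s : Fin N → Fin (c + 1)) (hr : Antitone r) (hs : Antitone s) :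
    (∀ j : Fin (c + 1),
        (Finset.univ.filter fun i => j ≤ r i).card ≤ (Finset.univ.filter fun i => j ≤ s i).card)
      ↔ ∀ i : Fin N, r i ≤ s i := by
  constructor
  · intro h i
    by_contra hlt
    have hlt : s i < r i := not_le.mp hlt
    refine absurd (h (r i)) (not_le.mpr (Finset.card_lt_card ?_))
    rw [Finset.ssubset_iff_of_subset]
    · exact ⟨i, by simp, by simpa using hlt⟩
    · intro k hk
      simp only [Finset.mem_filter, Finset.mem_univ, true_and] at hk ⊢
      rcases le_total k i with hki | hik
      · exact hr hki
      · exact absurd (hk.trans (hs hik)) (not_le.mpr hlt)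
  · intro h j
    refine Finset.card_le_card fun i hi => ?_
    simp only [Finset.mem_filter, Finset.mem_univ, true_and] at hi ⊢
    exact hi.trans (h i)
end

section
/- The graded rank-biased precision gRBP is a positive valuation on the lattice of rank-based judged runs with the replacement [rank-based] (pointwise) ordering: for all runs r, s, gRBP(r ⊔ s) + gRBP(r ⊓ s) = gRBP(r) + gRBP(s); and if r ≤ s with r ≠ s then gRBP(r) < gRBP(s). -/
/-- Graded rank-biased precision is a positive valuation on the lattice of rank-based
judged runs with the replacement [rank-based] (pointwise) ordering. -/
theorem rankBased_gRBP_positive_valuation (N c : ℕ) (hN : 1 ≤ N) (hc : 1 ≤ c)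
    (g : Fin (c + 1) → ℝ) (hg : StrictMono g) (hg0 : g 0 = 0)
    (p : ℝ) (hp0 : 0 < p) (hp1 : p < 1)
    (gRBP : (Fin N → Fin (c + 1)) → ℝ)
    (hgRBP : ∀ r : Fin N → Fin (c + 1),
      gRBP r = ((1 - p) / g (Fin.last c)) * ∑ i : Fin N, p ^ (i : ℕ) * g (r i)) :
    (∀ r s : Fin N → Fin (c + 1), gRBP (r ⊔ s) + gRBP (r ⊓ s) = gRBP r + gRBP s) ∧
    (∀ r s : Fin N → Fin (c + 1), r ≤ s → r ≠ s → gRBP r < gRBP s) := by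
  constructor
  · intro r s
    simp only [hgRBP]
    rw [← mul_add, ← mul_add, ← Finset.sum_add_distrib, ← Finset.sum_add_distrib]
    congr 1
    refine Finset.sum_congr rfl fun i _ => ?_
    rw [Pi.sup_apply, Pi.inf_apply]
    rcases le_total (r i) (s i) with h | h
    · rw [sup_eq_right.2 h, inf_eq_left.2 h, add_comm]
    · rw [sup_eq_left.2 h, inf_eq_right.2 h]
  · intro r s hrs hne
    have hlast : 0 < g (Fin.last c) := by
      rw [← hg0]
      apply hg
      rw [Fin.lt_def]
      simp
      omega
    rw [hgRBP, hgRBP]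
    apply mul_lt_mul_of_pos_left _ (div_pos (by linarith) hlast)
    obtain ⟨i, hi⟩ := Function.ne_iff.1 hne
    apply Finset.sum_lt_sum
    · intro j _
      exact mul_le_mul_of_nonneg_left (hg.monotone (hrs j)) (by positivity)
    · exact ⟨i, Finset.mem_univ i,
        mul_lt_mul_of_pos_left (hg (lt_of_le_of_ne (hrs i) hi)) (by positivity)⟩
end

section
/- The discounted cumulated gain DCG_b is a positive valuation on the lattice of rank-based judged runs with the replacement [rank-based] (pointwise) ordering: for all runs r, s, DCG_b(r ⊔ s) + DCG_b(r ⊓ s) = DCG_b(r) + DCG_b(s); and if r ≤ s with r ≠ s then DCG_b(r) < DCG_b(s). -/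
/-- Discounted cumulated gain is a positive valuation on the lattice of rank-based
judged runs with the replacement [rank-based] (pointwise) ordering. -/
theorem rankBased_DCG_positive_valuation (N c : ℕ) (hN : 1 ≤ N) (hc : 1 ≤ c)
    (g : Fin (c + 1) → ℝ) (hg : StrictMono g) (hg0 : g 0 = 0)
    (b : ℝ) (hb : 1 < b)
    (DCG : (Fin N → Fin (c + 1)) → ℝ)
    (hDCG : ∀ r : Fin N → Fin (c + 1),
      DCG r = ∑ i : Fin N, g (r i) / max 1 (Real.logb b ((i : ℕ) + 1))) :
    (∀ r s : Fin N → Fin (c + 1), DCG (r ⊔ s) + DCG (r ⊓ s) = DCG r + DCG s) ∧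
    (∀ r s : Fin N → Fin (c + 1), r ≤ s → r ≠ s → DCG r < DCG s) := by
  have hpos : ∀ i : Fin N, 0 < max 1 (Real.logb b ((i : ℕ) + 1)) := fun i =>
    lt_of_lt_of_le one_pos (le_max_left _ _)
  constructor
  · intro r s
    simp only [hDCG, ← Finset.sum_add_distrib]
    refine Finset.sum_congr rfl fun i _ => ?_
    rw [Pi.sup_apply, Pi.inf_apply]
    rcases le_total (r i) (s i) with h | h
    · rw [sup_eq_right.2 h, inf_eq_left.2 h, add_comm]
    · rw [sup_eq_left.2 h, inf_eq_right.2 h]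
  · intro r s hrs hne
    rw [hDCG, hDCG]
    obtain ⟨i, hi⟩ := Function.ne_iff.1 hne
    refine Finset.sum_lt_sum (fun j _ => ?_) ⟨i, Finset.mem_univ i, ?_⟩
    · exact div_le_div_of_nonneg_right (hg.monotone (hrs j)) (hpos j).le
    · exact div_lt_div_of_pos_right (hg (lt_of_le_of_ne (hrs i) hi)) (hpos i)
end

section
/- Let g be a gain function, let G = min_{1 ≤ j ≤ c} (g j − g (j−1)) / g c be the normalized smallest gap between the gains of two consecutive relevance degrees, and let 0 < p < 1. Then p ≤ G/(G+1) if and only if, for every N ≥ 1, the graded rank-biased precision gRBP on runs of length N is monotone with respect to the projection+replacement [rank-based] (lexicographic) ordering, i.e. r ≤lex s implies gRBP(r) ≤ gRBP(s). -/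
/-- Graded rank-biased precision of a run of length `N`. -/
noncomputable def gRBP (c : ℕ) (g : Fin (c + 1) → ℝ) (p : ℝ) {N : ℕ}
    (r : Fin N → Fin (c + 1)) : ℝ :=
  ((1 - p) / g (Fin.last c)) * ∑ i : Fin N, p ^ (i : ℕ) * g (r i)

/-- The projection+replacement [rank-based] ordering: the lexicographic order on
`Fin N → Fin (c+1)` with position `0` most significant. -/
def lexLE {N c : ℕ} (r s : Fin N → Fin (c + 1)) : Prop :=
  r = s ∨ ∃ k : Fin N, (∀ i : Fin N, i < k → r i = s i) ∧ r k < s k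

/-- The unnormalised discounted gain. -/
noncomputable def discSum (c : ℕ) (g : Fin (c + 1) → ℝ) (p : ℝ) {N : ℕ}
    (r : Fin N → Fin (c + 1)) : ℝ := ∑ i : Fin N, p ^ (i : ℕ) * g (r i)

theorem discSum_succ (c : ℕ) (g : Fin (c + 1) → ℝ) (p : ℝ) {N : ℕ}
    (r : Fin (N + 1) → Fin (c + 1)) :
    discSum c g p r = g (r 0) + p * discSum c g p (fun i : Fin N => r i.succ) := by
  unfold discSum
  rw [Fin.sum_univ_succ, Finset.mul_sum]
  simp [pow_succ']
  exact Finset.sum_congr rfl fun i _ => by ring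

theorem discSum_bounds (c : ℕ) (g : Fin (c + 1) → ℝ) (hg : StrictMono g) (hg0 : g 0 = 0)
    (p : ℝ) (hp0 : 0 < p) (hp1 : p < 1) (N : ℕ) (r : Fin N → Fin (c + 1)) :
    0 ≤ discSum c g p r ∧ (1 - p) * discSum c g p r ≤ g (Fin.last c) := by
  induction N with
  | zero =>
    have : g 0 ≤ g (Fin.last c) := hg.monotone (Fin.zero_le _)
    simp [discSum]
    linarith
  | succ n ih =>
    rw [discSum_succ]
    obtain ⟨h1, h2⟩ := ih (fun i => r i.succ)
    have h3 : g 0 ≤ g (r 0) := hg.monotone (Fin.zero_le _)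
    have h4 : g (r 0) ≤ g (Fin.last c) := hg.monotone (Fin.le_last _)
    constructor
    · have := mul_nonneg hp0.le h1
      linarith
    · nlinarith [mul_le_mul_of_nonneg_left h2 hp0.le,
        mul_le_mul_of_nonneg_left h4 (sub_nonneg.2 hp1.le)]

theorem discSum_mono (c : ℕ) (g : Fin (c + 1) → ℝ) (hg : StrictMono g) (hg0 : g 0 = 0)
    (p : ℝ) (hp0 : 0 < p) (hp1 : p < 1)
    (hgap : ∀ a b : Fin (c + 1), a < b → p * g (Fin.last c) ≤ (1 - p) * (g b - g a))
    (N : ℕ) (r s : Fin N → Fin (c + 1)) (h : lexLE r s) :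
    discSum c g p r ≤ discSum c g p s := by
  induction N with
  | zero => simp [discSum]
  | succ n ih =>
    rcases h with rfl | ⟨k, hk, hlt⟩
    · exact le_rfl
    rw [discSum_succ, discSum_succ c g p s]
    induction k using Fin.cases with
    | zero =>
      have h1 := (discSum_bounds c g hg hg0 p hp0 hp1 n (fun i => r i.succ)).2
      have h2 := (discSum_bounds c g hg hg0 p hp0 hp1 n (fun i => s i.succ)).1
      have h3 := hgap _ _ hlt
      have h4 := mul_nonneg hp0.le h2
      have h5 := mul_le_mul_of_nonneg_left h1 hp0.le
      have h6 : p * discSum c g p (fun i => r i.succ) ≤ g (s 0) - g (r 0) := by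
        have hq : 0 < 1 - p := by linarith
        refine le_of_mul_le_mul_left ?_ hq
        linarith
      linarith
    | succ k =>
      rw [hk 0 (Fin.succ_pos k)]
      have := ih (fun i => r i.succ) (fun i => s i.succ)
        (Or.inr ⟨k, fun i hi => hk _ (Fin.succ_lt_succ_iff.2 hi), hlt⟩)
      have := mul_le_mul_of_nonneg_left this hp0.le
      linarith

/-- Ferrante's criterion: `RBP` is monotone with respect to the projection+replacement
[rank-based] (lexicographic) ordering, for every run length `N ≥ 1`, if and only if
`p ≤ G/(G+1)`, where `G` is the normalized smallest gap between the gains of two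
consecutive relevance degrees. -/
theorem rbp_isotone_iff_persistence_le (c : ℕ) (hc : 1 ≤ c)
    (g : Fin (c + 1) → ℝ) (hg : StrictMono g) (hg0 : g 0 = 0)
    (G : ℝ)
    (hG : IsLeast {x : ℝ | ∃ j : Fin c, x = (g j.succ - g j.castSucc) / g (Fin.last c)} G)
    (p : ℝ) (hp0 : 0 < p) (hp1 : p < 1) :
    p ≤ G / (G + 1) ↔
      ∀ N : ℕ, 1 ≤ N → ∀ r s : Fin N → Fin (c + 1),
        lexLE r s → gRBP c g p r ≤ gRBP c g p s := by
  have hL : 0 < g (Fin.last c) := by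
    rw [← hg0]
    apply hg
    rw [Fin.lt_def]
    simp only [Fin.val_zero, Fin.val_last]
    omega
  obtain ⟨⟨j, hj⟩, hmin⟩ := hG
  have hGpos : 0 < G := by
    rw [hj]
    exact div_pos (sub_pos.2 (hg Fin.castSucc_lt_succ)) hL
  have hq : 0 < 1 - p := by linarith
  have key : p ≤ G / (G + 1) ↔ p ≤ (1 - p) * G := by
    rw [le_div_iff₀ (by linarith)]
    constructor <;> intro h <;> linarith
  have hmon : ∀ {N : ℕ} (r s : Fin N → Fin (c + 1)),
      gRBP c g p r ≤ gRBP c g p s ↔ discSum c g p r ≤ discSum c g p s := by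
    intro N r s
    exact mul_le_mul_iff_right₀ (div_pos hq hL)
  rw [key]
  constructor
  · intro h N _ r s hrs
    rw [hmon]
    refine discSum_mono c g hg hg0 p hp0 hp1 ?_ N r s hrs
    intro a b hab
    have hac : (a : ℕ) < c := by
      have := b.isLt
      have : (a : ℕ) < b := hab
      omega
    have h1 : G ≤ (g (Fin.succ ⟨a, hac⟩) - g (Fin.castSucc ⟨a, hac⟩)) / g (Fin.last c) :=
      hmin ⟨⟨a, hac⟩, rfl⟩
    rw [le_div_iff₀ hL] at h1
    have h2 : g (Fin.succ ⟨a, hac⟩) ≤ g b := hg.monotone (by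
      rw [Fin.le_def]
      exact hab)
    have h3 : Fin.castSucc ⟨a, hac⟩ = a := rfl
    rw [h3] at h1
    have h4 : G * g (Fin.last c) ≤ g b - g a := by linarith
    have h5 := mul_le_mul_of_nonneg_left h4 hq.le
    have h6 := mul_le_mul_of_nonneg_right h hL.le
    linarith
  · intro h
    have hn : ∀ n : ℕ, p * (1 - p ^ n) ≤ (1 - p) * G := by
      intro n
      have h1 := (hmon _ _).1 (h (n + 1) (by omega)
        (Fin.cons j.castSucc (fun _ => Fin.last c)) (Fin.cons j.succ (fun _ => 0))
        (Or.inr ⟨0, fun i hi => absurd hi (by simp), by simp⟩))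
      rw [discSum_succ, discSum_succ c g p (Fin.cons j.succ (fun _ => 0))] at h1
      simp only [Fin.cons_zero, Fin.cons_succ] at h1
      have h2 : discSum c g p (fun _ : Fin n => (0 : Fin (c + 1))) = 0 := by
        simp [discSum, hg0]
      have h3 : (1 - p) * discSum c g p (fun _ : Fin n => Fin.last c)
          = (1 - p ^ n) * g (Fin.last c) := by
        unfold discSum
        rw [← Finset.sum_mul, Fin.sum_univ_eq_sum_range (fun i => p ^ i), ← mul_assoc,
          mul_neg_geom_sum]
      have h4 : G * g (Fin.last c) = g j.succ - g j.castSucc := by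
        rw [hj]
        field_simp
      rw [h2] at h1
      have h5 : p * discSum c g p (fun _ : Fin n => Fin.last c) ≤ G * g (Fin.last c) := by
        linarith
      have h6 := mul_le_mul_of_nonneg_left h5 hq.le
      refine le_of_mul_le_mul_right ?_ hL
      have h7 : p * (1 - p ^ n) * g (Fin.last c)
          = p * ((1 - p) * discSum c g p (fun _ : Fin n => Fin.last c)) := by
        rw [h3]
        ring
      rw [h7]
      linarith
    have ht := tendsto_pow_atTop_nhds_zero_of_lt_one hp0.le hp1
    have ht2 := (ht.const_sub 1).const_mul p
    simp only [sub_zero, mul_one] at ht2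
    exact le_of_tendsto' ht2 hn
end

section
/- Let r, s : Fin N → Fin (c+1) be rank-based judged runs with r ≼ s in the swapping+replacement [rank-based] ordering, and let g : Fin (c+1) → ℝ be monotone. Then every prefix sum of gains of r is dominated by the corresponding prefix sum of gains of s: for every k ∈ Fin N, Σ_{i ≤ k} g(r i) ≤ Σ_{i ≤ k} g(s i). -/
/-- The swapping+replacement [rank-based] ordering: `r ≼ s` iff for every rank position
`k` and every relevance degree `j`, the number of positions `i ≤ k` of `r` with degree
at least `j` is at most that of `s`. -/
def swapLE {N c : ℕ} (r s : Fin N → Fin (c + 1)) : Prop :=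
  ∀ k : Fin N, ∀ j : Fin (c + 1),
    (Finset.univ.filter fun i => i ≤ k ∧ j ≤ r i).card ≤
      (Finset.univ.filter fun i => i ≤ k ∧ j ≤ s i).card

theorem gain_layer {c : ℕ} (g : Fin (c + 1) → ℝ) (x : Fin (c + 1)) :
    g x = g 0 + ∑ j : Fin c, (if j.succ ≤ x then g j.succ - g j.castSucc else 0) := by
  induction x using Fin.induction with
  | zero => simp [Fin.succ_ne_zero]
  | succ i ih =>
    have h : ∀ j : Fin c, (if j.succ ≤ i.succ then g j.succ - g j.castSucc else 0)
        = (if j.succ ≤ i.castSucc then g j.succ - g j.castSucc else 0)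
          + (if j = i then g j.succ - g j.castSucc else 0) := by
      intro j
      rcases lt_trichotomy j i with h | h | h
      · have h1 : j.succ ≤ i.succ := by simp only [Fin.le_def, Fin.lt_def, Fin.val_succ, Fin.val_castSucc] at *; omega
        have h2 : j.succ ≤ i.castSucc := by simp only [Fin.le_def, Fin.lt_def, Fin.val_succ, Fin.val_castSucc] at *; omega
        simp only [h1, h2, h.ne, if_true, if_false, add_zero]
      · subst h
        have h2 : ¬ j.succ ≤ j.castSucc := by simp [Fin.le_def]
        simp only [h2, le_refl, if_true, if_false, zero_add]
      · have h1 : ¬ j.succ ≤ i.succ := by simp only [Fin.le_def, Fin.lt_def, Fin.val_succ, Fin.val_castSucc] at *; omega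
        have h2 : ¬ j.succ ≤ i.castSucc := by simp only [Fin.le_def, Fin.lt_def, Fin.val_succ, Fin.val_castSucc] at *; omega
        simp only [h1, h2, h.ne', if_false, add_zero]
    rw [Finset.sum_congr rfl (fun j _ => h j), Finset.sum_add_distrib, ← add_assoc, ← ih]
    simp

theorem prefix_layer {N c : ℕ} (g : Fin (c + 1) → ℝ) (r : Fin N → Fin (c + 1)) (k : Fin N) :
    ∑ i ∈ Finset.Iic k, g (r i) = ∑ _i ∈ Finset.Iic k, g 0 +
      ∑ j : Fin c, ((Finset.univ.filter fun i => i ≤ k ∧ j.succ ≤ r i).card : ℝ)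
        * (g j.succ - g j.castSucc) := by
  rw [Finset.sum_congr rfl (fun i _ => gain_layer g (r i)), Finset.sum_add_distrib,
    Finset.sum_comm]
  congr 1
  refine Finset.sum_congr rfl fun j _ => ?_
  rw [← Finset.sum_filter, Finset.sum_const, nsmul_eq_mul]
  congr 3
  ext i
  simp

/-- If `r ≼ s` in the swapping+replacement [rank-based] ordering and `g` is monotone,
then every prefix sum of gains of `r` is dominated by that of `s`. -/
theorem swapRepl_prefix_sums (N c : ℕ) (hN : 1 ≤ N) (hc : 1 ≤ c)
    (r s : Fin N → Fin (c + 1)) (hrs : swapLE r s)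
    (g : Fin (c + 1) → ℝ) (hg : Monotone g) :
    ∀ k : Fin N, ∑ i ∈ Finset.Iic k, g (r i) ≤ ∑ i ∈ Finset.Iic k, g (s i) := by
  intro k
  rw [prefix_layer g r k, prefix_layer g s k]
  refine add_le_add le_rfl (Finset.sum_le_sum fun j _ => ?_)
  refine mul_le_mul_of_nonneg_right (by exact_mod_cast hrs k j.succ) ?_
  exact sub_nonneg.mpr (hg j.castSucc_lt_succ.le)
end

section
/- The graded rank-biased precision gRBP is monotone with respect to the swapping+replacement [rank-based] ordering: if r ≼ s then gRBP(r) ≤ gRBP(s). -/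
lemma aux_layer {c : ℕ} (g : Fin (c + 1) → ℝ) (a : Fin (c + 1)) :
    g a = g 0 + ∑ j : Fin c, (g j.succ - g j.castSucc) * (if j.succ ≤ a then 1 else 0) := by
  induction a using Fin.induction with
  | zero => simp [Fin.succ_ne_zero]
  | succ a ih =>
    have h : ∀ j : Fin c, (g j.succ - g j.castSucc) * (if j.succ ≤ a.succ then (1 : ℝ) else 0)
        = (g j.succ - g j.castSucc) * (if j.succ ≤ a.castSucc then 1 else 0)
          + (if j = a then g j.succ - g j.castSucc else 0) := by
      intro j
      simp only [Fin.le_def, Fin.val_succ, Fin.val_castSucc, Fin.ext_iff]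
      split_ifs <;> first | omega | simp
    rw [Finset.sum_congr rfl (fun j _ => h j), Finset.sum_add_distrib, ← add_assoc, ← ih]
    simp

lemma aux_sum {N c : ℕ} (g : Fin (c + 1) → ℝ) (hg : StrictMono g) (T : Finset (Fin N))
    (r s : Fin N → Fin (c + 1))
    (h : ∀ j : Fin (c + 1), (T.filter fun i => j ≤ r i).card ≤ (T.filter fun i => j ≤ s i).card) :
    ∑ i ∈ T, g (r i) ≤ ∑ i ∈ T, g (s i) := by
  have key : ∀ t : Fin N → Fin (c + 1), ∑ i ∈ T, g (t i) = ∑ i ∈ T, g 0 +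
      ∑ j : Fin c, (g j.succ - g j.castSucc) * ((T.filter fun i => j.succ ≤ t i).card : ℝ) := by
    intro t
    rw [Finset.sum_congr rfl (fun i _ => aux_layer g (t i)), Finset.sum_add_distrib,
      Finset.sum_comm]
    congr 1
    refine Finset.sum_congr rfl fun j _ => ?_
    rw [← Finset.mul_sum, Finset.sum_boole]
  rw [key r, key s]
  refine add_le_add le_rfl (Finset.sum_le_sum fun j _ => ?_)
  refine mul_le_mul_of_nonneg_left (by exact_mod_cast h j.succ) ?_
  exact sub_nonneg.2 (hg.monotone (Fin.castSucc_lt_succ).le)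

lemma aux_abel (p : ℝ) (hp0 : 0 < p) (hp1 : p < 1) : ∀ (N : ℕ) (d : Fin N → ℝ),
    (∀ k : Fin N, 0 ≤ ∑ i : Fin N, if i ≤ k then d i else 0) →
    p ^ N * ∑ i, d i ≤ ∑ i : Fin N, p ^ (i : ℕ) * d i ∧ 0 ≤ ∑ i, d i := by
  intro N
  induction N with
  | zero => intro d _; simp
  | succ n ih =>
    intro d hd
    have h1 : 0 ≤ ∑ i, d i := by simpa [Fin.le_last] using hd (Fin.last n)
    obtain ⟨h2, _⟩ := ih (fun i => d i.castSucc) (by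
      intro k
      have := hd k.castSucc
      rw [Fin.sum_univ_castSucc, if_neg (not_le.2 (Fin.castSucc_lt_last k))] at this
      simpa using this)
    refine ⟨?_, h1⟩
    have h3 : p ^ (n + 1) ≤ p ^ n := pow_le_pow_of_le_one hp0.le hp1.le (Nat.le_succ n)
    have h4 := mul_le_mul_of_nonneg_right h3 h1
    refine h4.trans ?_
    rw [Fin.sum_univ_castSucc, Fin.sum_univ_castSucc, mul_add]
    simpa using h2

/-- Graded rank-biased precision is monotone with respect to the swapping+replacement
[rank-based] ordering. -/
theorem swapRepl_gRBP_isotone (N c : ℕ) (hN : 1 ≤ N) (hc : 1 ≤ c)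
    (g : Fin (c + 1) → ℝ) (hg : StrictMono g) (hg0 : g 0 = 0)
    (p : ℝ) (hp0 : 0 < p) (hp1 : p < 1)
    (gRBP : (Fin N → Fin (c + 1)) → ℝ)
    (hgRBP : ∀ r : Fin N → Fin (c + 1),
      gRBP r = ((1 - p) / g (Fin.last c)) * ∑ i : Fin N, p ^ (i : ℕ) * g (r i)) :
    ∀ r s : Fin N → Fin (c + 1), swapLE r s → gRBP r ≤ gRBP s := by
  intro r s hrs
  rw [hgRBP, hgRBP]
  have hlast : 0 ≤ g (Fin.last c) := hg0 ▸ hg.monotone (Fin.zero_le _)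
  refine mul_le_mul_of_nonneg_left ?_ (div_nonneg (by linarith) hlast)
  obtain ⟨h1, h2⟩ := aux_abel p hp0 hp1 N (fun i => g (s i) - g (r i)) (by
    intro k
    rw [← Finset.sum_filter, Finset.sum_sub_distrib]
    refine sub_nonneg.2 (aux_sum g hg _ r s fun j => ?_)
    simpa only [Finset.filter_filter] using hrs k j)
  have h3 := (mul_nonneg (pow_pos hp0 N).le h2).trans h1
  simp only [mul_sub, Finset.sum_sub_distrib] at h3
  linarith
end

section
/- The discounted cumulated gain DCG_b is monotone with respect to the swapping+replacement [rank-based] ordering: if r ≼ s then DCG_b(r) ≤ DCG_b(s). -/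
theorem abel_aux (w a : ℕ → ℝ) (hw : Antitone w) (n : ℕ)
    (ha : ∀ m ≤ n, 0 ≤ ∑ i ∈ Finset.range m, a i) :
    w n * ∑ i ∈ Finset.range n, a i ≤ ∑ i ∈ Finset.range n, w i * a i := by
  induction n with
  | zero => simp
  | succ n ih =>
    have h1 := ih (fun m hm => ha m (by omega))
    have h2 := ha (n + 1) le_rfl
    have h3 := mul_le_mul_of_nonneg_right (hw (Nat.le_succ n)) h2
    rw [Finset.sum_range_succ (fun i => w i * a i)]
    rw [Finset.sum_range_succ a] at h3 ⊢
    simp only [Nat.succ_eq_add_one] at h3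
    linarith [mul_add (w n) (∑ i ∈ Finset.range n, a i) (a n)]

theorem abel_fin (w : ℕ → ℝ) (hw : Antitone w) (hw0 : ∀ n, 0 ≤ w n) (N : ℕ) (f : Fin N → ℝ)
    (hf : ∀ k : Fin N, 0 ≤ ∑ i : Fin N, if i ≤ k then f i else 0) :
    0 ≤ ∑ i : Fin N, w i * f i := by
  let a : ℕ → ℝ := fun n => if h : n < N then f ⟨n, h⟩ else 0
  have hfa : ∀ i : Fin N, f i = a i := fun i => by simp [a]
  have ha : ∀ m ≤ N, 0 ≤ ∑ i ∈ Finset.range m, a i := by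
    intro m hm
    rcases m with _ | k
    · simp
    · have h := hf ⟨k, hm⟩
      have e : (∑ i : Fin N, if i ≤ ⟨k, hm⟩ then f i else 0)
          = ∑ i : Fin N, (fun n : ℕ => if n ≤ k then a n else 0) i := by
        refine Finset.sum_congr rfl fun i _ => ?_
        simp only [hfa, Fin.le_def]
      rw [e, Fin.sum_univ_eq_sum_range (fun n : ℕ => if n ≤ k then a n else 0), ← Finset.sum_filter] at h
      convert h using 2
      ext x
      simp only [Finset.mem_filter, Finset.mem_range]
      omega
  have h := abel_aux w a hw N ha
  have e : ∑ i : Fin N, w i * f i = ∑ i : Fin N, (fun n : ℕ => w n * a n) i :=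
    Finset.sum_congr rfl fun i _ => by simp only [hfa]
  rw [e, Fin.sum_univ_eq_sum_range (fun n : ℕ => w n * a n)]
  exact (mul_nonneg (hw0 N) (ha N le_rfl)).trans h

theorem layer_cake (c : ℕ) (g : Fin (c + 1) → ℝ) (hg0 : g 0 = 0) (x : Fin (c + 1)) :
    g x = ∑ j : Fin c, (g j.succ - g j.castSucc) * (if j.succ ≤ x then 1 else 0) := by
  induction x using Fin.induction with
  | zero =>
    rw [hg0]
    symm
    refine Finset.sum_eq_zero fun j _ => ?_
    simp
  | succ i ih =>
    have e : g i.succ = g i.castSucc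
        + ∑ j : Fin c, (if j = i then (g j.succ - g j.castSucc) else 0) := by simp
    rw [e, ih, ← Finset.sum_add_distrib]
    refine Finset.sum_congr rfl fun j _ => ?_
    rcases lt_trichotomy j i with h | h | h <;>
      simp only [Fin.le_def, Fin.lt_def, Fin.ext_iff, Fin.val_succ, Fin.val_castSucc] at h ⊢
    · rw [if_pos (by omega), if_neg (by omega), if_pos (by omega)]; ring
    · rw [if_neg (by omega), if_pos (by omega), if_pos (by omega)]; ring
    · rw [if_neg (by omega), if_neg (by omega), if_neg (by omega)]; ring

/-- Discounted cumulated gain is monotone with respect to the swapping+replacement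
[rank-based] ordering. -/
theorem swapRepl_DCG_isotone (N c : ℕ) (hN : 1 ≤ N) (hc : 1 ≤ c)
    (g : Fin (c + 1) → ℝ) (hg : StrictMono g) (hg0 : g 0 = 0)
    (b : ℝ) (hb : 1 < b)
    (DCG : (Fin N → Fin (c + 1)) → ℝ)
    (hDCG : ∀ r : Fin N → Fin (c + 1),
      DCG r = ∑ i : Fin N, g (r i) / max 1 (Real.logb b ((i : ℕ) + 1))) :
    ∀ r s : Fin N → Fin (c + 1), swapLE r s → DCG r ≤ DCG s := by
  intro r s hrs
  let w : ℕ → ℝ := fun n => 1 / max 1 (Real.logb b ((n : ℝ) + 1))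
  have hpos : ∀ n : ℕ, 0 < max 1 (Real.logb b ((n : ℝ) + 1)) := fun n =>
    lt_of_lt_of_le one_pos (le_max_left _ _)
  have hw0 : ∀ n, 0 ≤ w n := fun n => (one_div_pos.2 (hpos n)).le
  have hw : Antitone w := by
    intro m n hmn
    refine one_div_le_one_div_of_le (hpos m) (max_le_max le_rfl ?_)
    have : (m : ℝ) ≤ n := by exact_mod_cast hmn
    exact Real.logb_le_logb_of_le hb (by positivity) (by linarith)
  have key : ∀ t : Fin N → Fin (c + 1), DCG t = ∑ j : Fin c, (g j.succ - g j.castSucc) *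
      ∑ i : Fin N, w i * (if j.succ ≤ t i then 1 else 0) := by
    intro t
    rw [hDCG]
    simp only [Finset.mul_sum]
    rw [Finset.sum_comm]
    refine Finset.sum_congr rfl fun i _ => ?_
    rw [layer_cake c g hg0 (t i), Finset.sum_div]
    refine Finset.sum_congr rfl fun j _ => ?_
    simp only [w]
    ring
  rw [key, key]
  refine Finset.sum_le_sum fun j _ => mul_le_mul_of_nonneg_left ?_
    (sub_nonneg.2 (hg Fin.castSucc_lt_succ).le)
  rw [← sub_nonneg, ← Finset.sum_sub_distrib]
  simp only [← mul_sub]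
  refine abel_fin w hw hw0 N _ fun k => ?_
  have h := hrs k j.succ
  have e : ∀ t : Fin N → Fin (c + 1),
      (((Finset.univ.filter fun i => i ≤ k ∧ j.succ ≤ t i).card : ℕ) : ℝ)
      = ∑ i : Fin N, if i ≤ k then (if j.succ ≤ t i then (1 : ℝ) else 0) else 0 := by
    intro t
    rw [Finset.card_filter]
    push_cast
    simp only [ite_and]
  have h' := (Nat.cast_le (α := ℝ)).2 h
  rw [e, e, ← sub_nonneg, ← Finset.sum_sub_distrib] at h'
  refine h'.trans_eq (Finset.sum_congr rfl fun i _ => ?_)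
  by_cases hi : i ≤ k <;> simp only [hi, if_true, if_false, sub_zero]
end
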